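/- Let (I,J) be a partial permutation of size k with cycle-path type (μ,ν), and let f_{(μ,ν)} ∈ ℤ[n, m_1, …, m_k] be the polynomial satisfying (n)_m · E_λ[1_{IJ}] = f_{(μ,ν)}(n, m_1(λ), …, m_k(λ)) for all partitions λ, where m = |I ∪ J|. Then every monomial n^{a_0} m_1^{a_1} m_2^{a_2} ⋯ m_k^{a_k} of f_{(μ,ν)} of weighted degree exactly k (under deg n = 1, deg m_i = i) satisfies a_1 ≥ m_1(μ) and a_0 + (a_1 − m_1(μ)) ≤ m_1(ν). -/

import Mathlib

open Finset Filter
open scoped Classical BigOperators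

namespace PaperStmt

/-- One step of the partial injection encoded by the tuples `I`, `J`. -/
noncomputable def pstep {k : ℕ} (I J : Fin k → ℕ) (x : ℕ) : Option ℕ :=
  if h : ∃ ℓ, I ℓ = x then some (J h.choose) else none

/-- Iterates of the partial injection encoded by `I`, `J`. -/
noncomputable def piter {k : ℕ} (I J : Fin k → ℕ) : ℕ → ℕ → Option ℕ
  | 0, x => some x
  | t + 1, x => (piter I J t x).bind (pstep I J)

/-- The vertex set of the graph `G(I,J)`. -/
def pverts {k : ℕ} (I J : Fin k → ℕ) : Finset ℕ :=
  Finset.image I Finset.univ ∪ Finset.image J Finset.univ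

/-- The number of directed cycles of length `i` in the graph `G(I,J)`. -/
noncomputable def cycleMult {k : ℕ} (I J : Fin k → ℕ) (i : ℕ) : ℕ :=
  ((pverts I J).filter fun x =>
    piter I J i x = some x ∧ ∀ t, 0 < t → t < i → piter I J t x ≠ some x).card / i

/-- The number of directed path components with exactly `ℓ` edges in `G(I,J)`. -/
noncomputable def pathMult {k : ℕ} (I J : Fin k → ℕ) (ℓ : ℕ) : ℕ :=
  ((pverts I J).filter fun x =>
    (∀ a, J a ≠ x) ∧ (piter I J ℓ x).isSome ∧ piter I J (ℓ + 1) x = none).card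

/-- The cycle partition `μ` of the partial permutation `(I,J)`. -/
noncomputable def cyclePart {k : ℕ} (I J : Fin k → ℕ) : Multiset ℕ :=
  ∑ i ∈ Finset.range (k + 1), Multiset.replicate (cycleMult I J i) i

/-- The path partition `ν` of the partial permutation `(I,J)`. -/
noncomputable def pathPart {k : ℕ} (I J : Fin k → ℕ) : Multiset ℕ :=
  ∑ i ∈ Finset.range (k + 1), Multiset.replicate (pathMult I J i) i

/-- The full cycle type of a permutation (including fixed points as parts equal to 1). -/
noncomputable def fullCycleType {n : ℕ} (π : Equiv.Perm (Fin n)) : Multiset ℕ :=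
  π.cycleType + Multiset.replicate (n - π.support.card) 1

/-- The conjugacy class `K_λ` of permutations of cycle type `λ`. -/
noncomputable def KClass {n : ℕ} (lam : Nat.Partition n) : Finset (Equiv.Perm (Fin n)) :=
  Finset.univ.filter fun π => fullCycleType π = lam.parts

/-- Expectation of a statistic over the uniform distribution on `K_λ`. -/
noncomputable def expect {n : ℕ} (lam : Nat.Partition n) (f : Equiv.Perm (Fin n) → ℝ) : ℝ :=
  (∑ π ∈ KClass lam, f π) / (KClass lam).card

/-- The indicator `1_{IJ}` of the partial permutation `(I,J)` in `S_n`. -/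
noncomputable def indic {n k : ℕ} (I J : Fin k → Fin n) (π : Equiv.Perm (Fin n)) : ℝ :=
  if ∀ ℓ, π (I ℓ) = J ℓ then 1 else 0

/-- The weighted degree of an exponent vector, with `deg X_0 = 1` and `deg X_i = i` for `i ≥ 1`. -/
def wdeg (d : ℕ →₀ ℕ) : ℕ := d.sum fun i e => max i 1 * e

lemma wdeg_add (d e : ℕ →₀ ℕ) : wdeg (d + e) = wdeg d + wdeg e :=
  Finsupp.sum_add_index' (fun _ => by simp) fun _ _ _ => by ring

lemma wdeg_single (i e : ℕ) : wdeg (Finsupp.single i e) = max i 1 * e := by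
  simp [wdeg]

/-- Every monomial of `P` has weighted degree at most `w`, and those of weighted degree exactly
`w` have `X_1`-exponent at least `c` and total exponent in `X_0, X_1` at most `b`. -/
def TopBound (w c b : ℕ) (P : MvPolynomial ℕ ℤ) : Prop :=
  ∀ d ∈ P.support, wdeg d ≤ w ∧ (wdeg d = w → c ≤ d 1 ∧ d 0 + d 1 ≤ b)

lemma TopBound.mono {w c b w' c' b' : ℕ} {P : MvPolynomial ℕ ℤ} (h : TopBound w c b P)
    (hw : w ≤ w') (hcb : w = w' → c' ≤ c ∧ b ≤ b') : TopBound w' c' b' P := by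
  intro d hd
  obtain ⟨h1, h2⟩ := h d hd
  refine ⟨h1.trans hw, fun h3 => ?_⟩
  have h4 : w = w' := by omega
  have := hcb h4
  have := h2 (by omega)
  omega

lemma topBound_zero (w c b : ℕ) : TopBound w c b 0 := fun d hd => by simp at hd

lemma TopBound.sub {w c b : ℕ} {P Q : MvPolynomial ℕ ℤ} (hP : TopBound w c b P)
    (hQ : TopBound w c b Q) : TopBound w c b (P - Q) := by
  intro d hd
  rcases Finset.mem_union.1 (MvPolynomial.support_sub ℕ P Q hd) with h | h
  exacts [hP d h, hQ d h]

lemma TopBound.add {w c b : ℕ} {P Q : MvPolynomial ℕ ℤ} (hP : TopBound w c b P)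
    (hQ : TopBound w c b Q) : TopBound w c b (P + Q) := by
  intro d hd
  rcases Finset.mem_union.1 (MvPolynomial.support_add hd) with h | h
  exacts [hP d h, hQ d h]

lemma TopBound.sum {ι : Type*} {w c b : ℕ} (s : Finset ι) {P : ι → MvPolynomial ℕ ℤ}
    (hP : ∀ i ∈ s, TopBound w c b (P i)) : TopBound w c b (∑ i ∈ s, P i) :=
  Finset.sum_induction P (TopBound w c b) (fun _ _ => TopBound.add) (topBound_zero w c b) hP

lemma TopBound.mul {w c b w' c' b' : ℕ} {P Q : MvPolynomial ℕ ℤ} (hP : TopBound w c b P)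
    (hQ : TopBound w' c' b' Q) : TopBound (w + w') (c + c') (b + b') (P * Q) := by
  intro d hd
  obtain ⟨d₁, h₁, d₂, h₂, rfl⟩ := Finset.mem_add.1 (MvPolynomial.support_mul P Q hd)
  obtain ⟨a1, a2⟩ := hP _ h₁
  obtain ⟨b1, b2⟩ := hQ _ h₂
  rw [wdeg_add]
  refine ⟨by omega, fun h => ?_⟩
  have := a2 (by omega)
  have := b2 (by omega)
  simp only [Finsupp.add_apply]
  omega

lemma topBound_monomial {w c b : ℕ} (d : ℕ →₀ ℕ) (r : ℤ) (hw : wdeg d ≤ w)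
    (h : wdeg d = w → c ≤ d 1 ∧ d 0 + d 1 ≤ b) :
    TopBound w c b (MvPolynomial.monomial d r) := by
  intro e he
  obtain rfl : e = d := by simpa using MvPolynomial.support_monomial_subset he
  exact ⟨hw, h⟩

lemma topBound_C_mul_X_sub_C (i : ℕ) (r s : ℤ) :
    TopBound (max i 1) (if i = 1 then 1 else 0) (if i ≤ 1 then 1 else 0)
      (MvPolynomial.C r * MvPolynomial.X i - MvPolynomial.C s) := by
  refine TopBound.sub ?_ (topBound_monomial 0 s ?_ ?_)
  · rw [MvPolynomial.C_mul_X_eq_monomial]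
    refine topBound_monomial _ _ (by simp [wdeg_single]) fun _ => ?_
    rcases i with _ | _ | i <;> simp
  · simp [wdeg]
  · simp [wdeg]
    omega

/-- Large partitions realize any prescribed multiplicities of the parts in `s`. -/
lemma exists_partition_count (s : Finset ℕ) (x : ℕ → ℕ) (n : ℕ)
    (hn : ∑ i ∈ s, x i * i + (s.sup id + 1) ≤ n) :
    ∃ lam : Nat.Partition n, ∀ i ∈ s, i ≠ 0 → Multiset.count i lam.parts = x i := by
  set r := n - ∑ i ∈ s, x i * i with hr
  refine ⟨⟨∑ i ∈ s.erase 0, Multiset.replicate (x i) i + {r}, ?_, ?_⟩, ?_⟩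
  · intro i hi
    rw [Multiset.mem_add, Multiset.mem_sum, Multiset.mem_singleton] at hi
    rcases hi with ⟨j, hj, hi⟩ | hi
    · have := Multiset.eq_of_mem_replicate hi
      have := Finset.ne_of_mem_erase hj
      omega
    · omega
  · rw [Multiset.sum_add, Multiset.sum_singleton, Multiset.sum_sum]
    simp only [Multiset.sum_replicate, smul_eq_mul]
    rw [Finset.sum_erase _ (by simp)]
    omega
  · intro i hi hi0
    have h1 : i ≠ r := by
      have := Finset.le_sup (f := id) hi
      simp only [id] at this
      omega
    simp only [Multiset.count_add, Multiset.count_sum', Multiset.count_replicate,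
      Multiset.count_singleton, if_neg h1, add_zero]
    rw [Finset.sum_ite_eq']
    simp [hi, hi0]

/-- The point at which the polynomials are evaluated: `n` in coordinate `0`, multiplicities in the
others. -/
def evalPoint (n : ℕ) (s : Multiset ℕ) (i : ℕ) : ℤ := if i = 0 then (n : ℤ) else (s.count i : ℤ)

lemma eq_zero_of_eval_evalPoint (m : ℕ) (P : MvPolynomial ℕ ℤ)
    (h : ∀ n, m ≤ n → ∀ lam : Nat.Partition n,
      MvPolynomial.eval (evalPoint n lam.parts) P = 0) : P = 0 := by
  obtain ⟨s, Q, rfl⟩ := MvPolynomial.exists_finset_rename P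
  suffices hQ : Q = 0 by rw [hQ, map_zero]
  set D := Q.totalDegree with hD
  set B := ∑ i ∈ s, D * i + (s.sup id + 1) + m with hB
  refine MvPolynomial.eq_zero_of_eval_zero_at_prod_finset Q
    (fun i => if (i : ℕ) = 0 then (Finset.Icc B (B + D)).image Nat.cast
      else (Finset.range (D + 1)).image Nat.cast) (fun i => ?_) fun x hx => ?_
  · have := MvPolynomial.degreeOf_le_totalDegree Q i
    split_ifs
    · rw [Finset.card_image_of_injective _ Nat.cast_injective, Nat.card_Icc]
      omega
    · rw [Finset.card_image_of_injective _ Nat.cast_injective, Finset.card_range]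
      omega
  · have hx1 : ∀ i : s, (i : ℕ) ≠ 0 → ∃ a ≤ D, (a : ℤ) = x i := by
      intro i hi
      have := hx i
      rw [if_neg hi] at this
      obtain ⟨a, ha, ha'⟩ := Finset.mem_image.1 this
      exact ⟨a, by simpa [Nat.lt_succ_iff] using ha, ha'⟩
    have hn : ∃ n, B ≤ n ∧ ∀ i : s, (i : ℕ) = 0 → (n : ℤ) = x i := by
      by_cases h0 : 0 ∈ s
      · have := hx ⟨0, h0⟩
        rw [if_pos rfl] at this
        obtain ⟨a, ha, ha'⟩ := Finset.mem_image.1 this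
        refine ⟨a, (Finset.mem_Icc.1 ha).1, ?_⟩
        rintro ⟨i, hi⟩ (rfl : i = 0)
        exact ha'
      · refine ⟨B, le_rfl, ?_⟩
        rintro ⟨i, hi⟩ (rfl : i = 0)
        exact absurd hi h0
    obtain ⟨n, hBn, hn⟩ := hn
    choose! a haD hax using hx1
    obtain ⟨lam, hlam⟩ := exists_partition_count s
      (fun i => if h : i ∈ s ∧ i ≠ 0 then a ⟨i, h.1⟩ else 0) n (by
        refine le_trans (Nat.add_le_add_right (Finset.sum_le_sum fun i hi => ?_) _)
          ((Nat.le_add_right _ m).trans hBn)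
        refine Nat.mul_le_mul_right _ ?_
        split_ifs with h
        · exact haD _ h.2
        · exact Nat.zero_le _)
    have := h n (by omega) lam
    rw [MvPolynomial.eval_rename] at this
    rw [← this]
    congr 2
    funext i
    simp only [Function.comp, evalPoint]
    split_ifs with h0
    · exact (hn i h0).symm
    · rw [hlam i i.2 h0, dif_pos ⟨i.2, h0⟩]
      exact (hax i h0).symm
lemma period_eq_card_sameCycle {V : Type} [Fintype V] (σ : Equiv.Perm V) (v : V) :
    MulAction.period σ v = #{x | σ.SameCycle v x} := by
  rw [MulAction.period_eq_minimalPeriod, MulAction.minimalPeriod_eq_card, ← Set.toFinset_card]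
  congr 1
  ext x
  simp only [Set.mem_toFinset, MulAction.mem_orbit_iff, Finset.mem_filter, Finset.mem_univ,
    true_and]
  constructor
  · rintro ⟨⟨_, j, rfl⟩, h⟩
    exact ⟨j, h⟩
  · rintro ⟨j, h⟩
    exact ⟨⟨σ ^ j, j, rfl⟩, h⟩

lemma period_perm_pos {V : Type} [Fintype V] (σ : Equiv.Perm V) (v : V) :
    0 < MulAction.period σ v := by
  rw [period_eq_card_sameCycle]
  exact Finset.card_pos.2 ⟨v, by simpa using Equiv.Perm.SameCycle.refl σ v⟩

lemma card_period_eq {n : ℕ} (π : Equiv.Perm (Fin n)) {i : ℕ} (hi : 0 < i) :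
    #{x : Fin n | MulAction.period π x = i} = i * Multiset.count i (fullCycleType π) := by
  have hsupp : ∀ x ∈ π.support, MulAction.period π x = #(π.cycleOf x).support := by
    intro x hx
    rw [period_eq_card_sameCycle]
    congr 1
    ext y
    rw [Equiv.Perm.mem_support_cycleOf_iff' (Equiv.Perm.mem_support.1 hx)]
    simp
  have hone : ∀ x, MulAction.period π x = 1 ↔ x ∉ π.support := by
    intro x
    rw [Equiv.Perm.notMem_support, MulAction.period_eq_one_iff]
    rfl
  rw [fullCycleType, Multiset.count_add, Multiset.count_replicate]
  rcases eq_or_ne i 1 with rfl | h1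
  · have h0 : Multiset.count 1 π.cycleType = 0 :=
      Multiset.count_eq_zero.2 fun h => by simpa using Equiv.Perm.two_le_of_mem_cycleType h
    simp only [hone, h0, if_true, zero_add, one_mul]
    have h2 := Finset.card_compl π.support
    rw [Fintype.card_fin] at h2
    rw [← h2]
    congr 1
    ext x
    simp
  · rw [if_neg (by omega), add_zero, Equiv.Perm.cycleType_def, Multiset.count_map]
    have hS : ({x | MulAction.period π x = i} : Finset (Fin n)) =
        (π.cycleFactorsFinset.filter fun c => i = (Finset.card ∘ Equiv.Perm.support) c).biUnion
          Equiv.Perm.support := by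
      ext x
      simp only [Finset.mem_filter, Finset.mem_univ, true_and, Finset.mem_biUnion,
        Function.comp]
      constructor
      · intro h
        have hx : x ∈ π.support := by
          by_contra hx
          have := (hone x).2 hx
          omega
        exact ⟨π.cycleOf x, ⟨Equiv.Perm.cycleOf_mem_cycleFactorsFinset_iff.2 hx,
          by rw [← hsupp x hx, h]⟩, Equiv.Perm.mem_support_cycleOf_iff.2 ⟨by rfl, hx⟩⟩
      · rintro ⟨c, ⟨hc, hci⟩, hxc⟩
        have hx := Equiv.Perm.mem_cycleFactorsFinset_support_le hc hxc
        rw [hsupp x hx, ← Equiv.Perm.cycle_is_cycleOf hxc hc, hci]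
    rw [hS, Finset.card_biUnion, Finset.sum_congr rfl (g := fun _ => i), Finset.sum_const,
      smul_eq_mul, mul_comm]
    · rfl
    · intro c hc
      exact (Finset.mem_filter.1 hc).2.symm
    · intro c hc d hd hcd
      exact (Equiv.Perm.cycleFactorsFinset_pairwise_disjoint π
        (Finset.mem_filter.1 hc).1 (Finset.mem_filter.1 hd).1 hcd).disjoint_support

section Equivariant

variable {V : Type} {n : ℕ} {σ : Equiv.Perm V} {π : Equiv.Perm (Fin n)} {φ : V → Fin n}

lemma equivariant_zpow (hφ : ∀ x, π (φ x) = φ (σ x)) (j : ℤ) (x : V) :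
    (π ^ j) (φ x) = φ ((σ ^ j) x) := by
  have hinv : ∀ x, π⁻¹ (φ x) = φ (σ⁻¹ x) := fun x => by
    rw [Equiv.Perm.inv_eq_iff_eq, hφ, ← Equiv.Perm.mul_apply, mul_inv_cancel, Equiv.Perm.one_apply]
  induction j generalizing x with
  | zero => simp
  | succ j ih => rw [zpow_add_one, zpow_add_one, Equiv.Perm.mul_apply, hφ, ih, Equiv.Perm.mul_apply]
  | pred j ih =>
    rw [zpow_sub_one, zpow_sub_one, Equiv.Perm.mul_apply, hinv, ih, Equiv.Perm.mul_apply]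

lemma equivariant_period (hinj : Function.Injective φ) (hφ : ∀ x, π (φ x) = φ (σ x)) (x : V) :
    MulAction.period π (φ x) = MulAction.period σ x := by
  have key : ∀ j : ℕ, MulAction.period π (φ x) ∣ j ↔ MulAction.period σ x ∣ j := by
    intro j
    rw [← MulAction.pow_smul_eq_iff_period_dvd, ← MulAction.pow_smul_eq_iff_period_dvd]
    have := equivariant_zpow hφ j x
    simp only [zpow_natCast] at this
    rw [Equiv.Perm.smul_def, Equiv.Perm.smul_def, this, hinj.eq_iff]
  exact Nat.dvd_antisymm ((key _).2 dvd_rfl) ((key _).1 dvd_rfl)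

end Equivariant

/-- The injections intertwining `σ` and `π`. -/
noncomputable def permEmbs {V : Type} [Fintype V] {n : ℕ} (σ : Equiv.Perm V)
    (π : Equiv.Perm (Fin n)) : Finset (V → Fin n) :=
  {φ | Function.Injective φ ∧ ∀ x, π (φ x) = φ (σ x)}

/-- The restriction of `σ` to the complement of the cycle through `v`. -/
noncomputable def offCycle {V : Type} (σ : Equiv.Perm V) (v : V) :
    Equiv.Perm {x // ¬ σ.SameCycle v x} :=
  σ.subtypePerm fun x => by rw [Equiv.Perm.sameCycle_apply_right]

lemma card_permEmbs_fiber {V : Type} [Fintype V] {n : ℕ} (σ : Equiv.Perm V)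
    (π : Equiv.Perm (Fin n)) (v : V) (ψ : {x // ¬ σ.SameCycle v x} → Fin n)
    (hψ : ψ ∈ permEmbs (offCycle σ v) π) :
    #{φ ∈ permEmbs σ π | φ ∘ Subtype.val = ψ} =
      #{x | MulAction.period π x = MulAction.period σ v ∧ x ∉ Set.range ψ} := by
  simp only [permEmbs, Finset.mem_filter, Finset.mem_univ, true_and] at hψ
  obtain ⟨hψi, hψe⟩ := hψ
  refine Finset.card_bij (fun φ _ => φ v) ?_ ?_ ?_
  · intro φ hφ
    simp only [permEmbs, Finset.mem_filter, Finset.mem_univ, true_and] at hφ ⊢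
    obtain ⟨⟨hi, he⟩, rfl⟩ := hφ
    refine ⟨equivariant_period hi he v, ?_⟩
    rintro ⟨⟨a, ha⟩, hav⟩
    obtain rfl : a = v := hi hav
    exact ha (by rfl)
  · intro φ hφ φ' hφ' hv
    simp only [permEmbs, Finset.mem_filter, Finset.mem_univ, true_and] at hφ hφ'
    funext x
    by_cases hx : σ.SameCycle v x
    · obtain ⟨j, rfl⟩ := hx
      rw [← equivariant_zpow hφ.1.2, ← equivariant_zpow hφ'.1.2, hv]
    · exact congrFun (hφ.2.trans hφ'.2.symm) ⟨x, hx⟩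
  · intro x₀ hx₀
    simp only [Finset.mem_filter, Finset.mem_univ, true_and] at hx₀
    obtain ⟨hper, hran⟩ := hx₀
    have hiff : ∀ j : ℤ, (π ^ j) x₀ = x₀ ↔ (σ ^ j) v = v := by
      intro j
      rw [← Equiv.Perm.smul_def, ← Equiv.Perm.smul_def, MulAction.zpow_smul_eq_iff_period_dvd,
        MulAction.zpow_smul_eq_iff_period_dvd, hper]
    have hiff2 : ∀ i j : ℤ, (π ^ i) x₀ = (π ^ j) x₀ ↔ (σ ^ i) v = (σ ^ j) v := by
      intro i j
      have := hiff (-j + i)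
      rw [zpow_add, zpow_add, Equiv.Perm.mul_apply, Equiv.Perm.mul_apply, zpow_neg, zpow_neg,
        Equiv.Perm.inv_eq_iff_eq, Equiv.Perm.inv_eq_iff_eq] at this
      exact this
    have hex : ∀ x : V, ∃ y : Fin n, (∀ h : ¬ σ.SameCycle v x, y = ψ ⟨x, h⟩) ∧
        ∀ j : ℤ, (σ ^ j) v = x → y = (π ^ j) x₀ := by
      intro x
      by_cases hx : σ.SameCycle v x
      · obtain ⟨i, hi⟩ := hx
        exact ⟨(π ^ i) x₀, fun h => absurd ⟨i, hi⟩ h, fun j hj => (hiff2 i j).2 (hi.trans hj.symm)⟩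
      · exact ⟨ψ ⟨x, hx⟩, fun _ => rfl, fun j hj => absurd ⟨j, hj⟩ hx⟩
    choose φ hφ1 hφ2 using hex
    have hψoff : ∀ (j : ℤ) a, (π ^ j) x₀ ≠ ψ a := by
      intro j a h
      have := equivariant_zpow hψe (-j) a
      rw [← h, zpow_neg, ← Equiv.Perm.mul_apply, inv_mul_cancel, Equiv.Perm.one_apply] at this
      exact hran ⟨_, this.symm⟩
    have heq : ∀ x, π (φ x) = φ (σ x) := by
      intro x
      by_cases hx : σ.SameCycle v x
      · obtain ⟨i, hi⟩ := hx
        rw [hφ2 x i hi, hφ2 (σ x) (1 + i) (by rw [zpow_add, Equiv.Perm.mul_apply, hi, zpow_one]),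
          zpow_add, Equiv.Perm.mul_apply, zpow_one]
      · have hx' : ¬ σ.SameCycle v (σ x) := by rwa [Equiv.Perm.sameCycle_apply_right]
        rw [hφ1 x hx, hφ1 _ hx', hψe]
        rfl
    have hinj : Function.Injective φ := by
      intro x y hxy
      by_cases hx : σ.SameCycle v x <;> by_cases hy : σ.SameCycle v y
      · obtain ⟨i, hi⟩ := hx
        obtain ⟨j, hj⟩ := hy
        rw [hφ2 x i hi, hφ2 y j hj, hiff2] at hxy
        rw [← hi, ← hj, hxy]
      · obtain ⟨i, hi⟩ := hx
        rw [hφ2 x i hi, hφ1 y hy] at hxy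
        exact absurd hxy (hψoff _ _)
      · obtain ⟨i, hi⟩ := hy
        rw [hφ2 y i hi, hφ1 x hx] at hxy
        exact absurd hxy.symm (hψoff _ _)
      · rw [hφ1 x hx, hφ1 y hy] at hxy
        exact congrArg Subtype.val (hψi hxy)
    refine ⟨φ, ?_, by simpa using hφ2 v 0 (by simp)⟩
    simp only [permEmbs, Finset.mem_filter, Finset.mem_univ, true_and]
    exact ⟨⟨hinj, heq⟩, funext fun a => hφ1 a.1 a.2⟩

lemma card_permEmbs_offCycle {V : Type} [Fintype V] {n : ℕ} (σ : Equiv.Perm V)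
    (π : Equiv.Perm (Fin n)) (v : V) :
    (#(permEmbs σ π) : ℤ) = (MulAction.period σ v *
        Multiset.count (MulAction.period σ v) (fullCycleType π) -
      #{a : {x // ¬ σ.SameCycle v x} | MulAction.period (offCycle σ v) a = MulAction.period σ v}) *
        #(permEmbs (offCycle σ v) π) := by
  rw [Finset.card_eq_sum_card_fiberwise (t := permEmbs (offCycle σ v) π)
    (f := fun φ => φ ∘ Subtype.val)]
  · rw [Finset.sum_congr rfl (card_permEmbs_fiber σ π v), Nat.cast_sum,
      Finset.sum_congr rfl (g := fun _ => ((MulAction.period σ v *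
        Multiset.count (MulAction.period σ v) (fullCycleType π) -
      #{a : {x // ¬ σ.SameCycle v x} | MulAction.period (offCycle σ v) a =
        MulAction.period σ v} : ℤ))),
      Finset.sum_const, nsmul_eq_mul, mul_comm]
    intro ψ hψ
    simp only [permEmbs, Finset.mem_filter, Finset.mem_univ, true_and] at hψ
    obtain ⟨hψi, hψe⟩ := hψ
    rw [eq_sub_iff_add_eq, ← Nat.cast_mul, ← card_period_eq π (period_perm_pos σ v),
      ← Nat.cast_add, Nat.cast_inj, ← Finset.card_image_of_injective _ hψi,
      ← Finset.card_union_of_disjoint]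
    · congr 1
      ext x
      simp only [Finset.mem_union, Finset.mem_filter, Finset.mem_univ, true_and, Finset.mem_image]
      constructor
      · rintro (h | ⟨a, ha, rfl⟩)
        · exact h.1
        · rw [equivariant_period hψi hψe, ha]
      · intro h
        by_cases hx : x ∈ Set.range ψ
        · obtain ⟨a, rfl⟩ := hx
          exact Or.inr ⟨a, by rw [← equivariant_period hψi hψe, h], rfl⟩
        · exact Or.inl ⟨h, hx⟩
    · rw [Finset.disjoint_left]
      intro x hx hx'
      obtain ⟨a, -, rfl⟩ := Finset.mem_image.1 hx'
      exact (Finset.mem_filter.1 hx).2.2 ⟨a, rfl⟩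
  · intro φ hφ
    simp only [permEmbs, Finset.coe_filter, Finset.mem_univ, true_and, Set.mem_ofPred_eq] at hφ ⊢
    exact ⟨hφ.1.comp Subtype.val_injective, fun x => hφ.2 x⟩

lemma card_eq_card_offCycle_add {V : Type} [Fintype V] (σ : Equiv.Perm V) (v : V) :
    Fintype.card V = MulAction.period σ v + Fintype.card {x // ¬ σ.SameCycle v x} := by
  rw [period_eq_card_sameCycle, Fintype.card_subtype, Finset.card_filter_add_card_filter_not,
    Finset.card_univ]

/-- The number of fixed points of a permutation. -/
noncomputable def fixCount {V : Type} [Fintype V] (σ : Equiv.Perm V) : ℕ := #{x | σ x = x}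

lemma fixCount_eq_fixCount_offCycle_add {V : Type} [Fintype V] (σ : Equiv.Perm V) (v : V) :
    fixCount σ = (if MulAction.period σ v = 1 then 1 else 0) + fixCount (offCycle σ v) := by
  have h1 : MulAction.period σ v = 1 ↔ σ v = v := by
    rw [MulAction.period_eq_one_iff]
    rfl
  rw [fixCount, ← Finset.card_filter_add_card_filter_not (s := ({x | σ x = x} : Finset V))
    (fun x => σ.SameCycle v x)]
  congr 1
  · split_ifs with h
    · rw [Finset.card_eq_one]
      refine ⟨v, ?_⟩
      ext x
      simp only [Finset.mem_filter, Finset.mem_univ, true_and, Finset.mem_singleton]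
      constructor
      · rintro ⟨hx, hvx⟩
        exact hvx.symm.eq_of_left hx
      · rintro rfl
        exact ⟨h1.1 h, by rfl⟩
    · rw [Finset.card_eq_zero, Finset.filter_eq_empty_iff]
      intro x hx hvx
      have hx' : σ x = x := (Finset.mem_filter.1 hx).2
      obtain rfl := hvx.symm.eq_of_left hx'
      exact h (h1.2 hx')
  · rw [fixCount]
    refine (Finset.card_bij (fun a _ => a.1) ?_ ?_ ?_).symm
    · intro a ha
      simp only [Finset.mem_filter, Finset.mem_univ, true_and] at ha ⊢
      exact ⟨congrArg Subtype.val ha, a.2⟩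
    · intro a _ b _ h
      exact Subtype.ext h
    · intro x hx
      simp only [Finset.mem_filter, Finset.mem_univ, true_and] at hx
      refine ⟨⟨x, hx.2⟩, ?_, rfl⟩
      simp only [Finset.mem_filter, Finset.mem_univ, true_and]
      exact Subtype.ext hx.1

theorem exists_topBound_permEmbs (m : ℕ) : ∀ (V : Type) [Fintype V] (σ : Equiv.Perm V),
    Fintype.card V = m → ∃ P : MvPolynomial ℕ ℤ,
      TopBound (Fintype.card V) (fixCount σ) (fixCount σ) P ∧
      ∀ n (π : Equiv.Perm (Fin n)),
        (#(permEmbs σ π) : ℤ) = MvPolynomial.eval (evalPoint n (fullCycleType π)) P := by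
  induction m using Nat.strong_induction_on with
  | _ m ih =>
    intro V _ σ hV
    rcases isEmpty_or_nonempty V with hE | ⟨⟨v⟩⟩
    · refine ⟨MvPolynomial.monomial 0 1, topBound_monomial _ _ (by simp [wdeg])
        (by simp [fixCount]), ?_⟩
      intro n π
      simp only [permEmbs, MvPolynomial.eval_monomial]
      rw [Finset.filter_true_of_mem fun φ _ =>
        ⟨Function.injective_of_subsingleton φ, fun x => isEmptyElim x⟩]
      simp
    · have hpos := period_perm_pos σ v
      have hcard := card_eq_card_offCycle_add σ v
      obtain ⟨P, hP, hPe⟩ := ih _ (by omega) _ (offCycle σ v) rfl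
      have hlin := topBound_C_mul_X_sub_C (MulAction.period σ v) (MulAction.period σ v)
        #{a : {x // ¬ σ.SameCycle v x} | MulAction.period (offCycle σ v) a = MulAction.period σ v}
      refine ⟨_, (hlin.mul hP).mono ?_ fun _ => ?_, fun n π => ?_⟩
      · rw [max_eq_left hpos, hcard]
      · rw [fixCount_eq_fixCount_offCycle_add σ v]
        constructor <;> split_ifs <;> omega
      · rw [card_permEmbs_offCycle σ π v, hPe, map_mul, map_sub, map_mul, MvPolynomial.eval_C,
          MvPolynomial.eval_C, MvPolynomial.eval_X, evalPoint, if_neg hpos.ne']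
/-- A relation that is the graph of a partial injection. -/
structure IsPartialInj {V : Type} (R : V → V → Prop) : Prop where
  right_unique : ∀ {x y y'}, R x y → R x y' → y = y'
  left_unique : ∀ {x x' y}, R x y → R x' y → x = x'

section Counts

variable {V : Type} [Fintype V] (R : V → V → Prop)

/-- The number of edges. -/
noncomputable def edgeCount : ℕ := #{p : V × V | R p.1 p.2}

/-- The number of loops. -/
noncomputable def loopCount : ℕ := #{x : V | R x x}

/-- The number of isolated vertices. -/
noncomputable def isolatedCount : ℕ := #{x : V | ∀ u, ¬ R x u ∧ ¬ R u x}

/-- The number of path components with exactly one edge. -/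
noncomputable def singleEdgeCount : ℕ :=
  #{p : V × V | R p.1 p.2 ∧ (∀ u, ¬ R u p.1) ∧ ∀ u, ¬ R p.2 u}

/-- The injections carrying the edges of `R` to edges of the functional graph of `π`. -/
noncomputable def graphEmbs {n : ℕ} (π : Equiv.Perm (Fin n)) : Finset (V → Fin n) :=
  {φ | Function.Injective φ ∧ ∀ x y, R x y → π (φ x) = φ y}

/-- The number of embeddings of `R` into permutations is a polynomial in the cycle counts, whose
top degree part is controlled by loops, isolated edges and isolated vertices. -/
def HasTopBound : Prop :=
  ∃ P : MvPolynomial ℕ ℤ,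
    TopBound (edgeCount R + isolatedCount R) (loopCount R)
      (loopCount R + singleEdgeCount R + isolatedCount R) P ∧
    ∀ n (π : Equiv.Perm (Fin n)),
      (#(graphEmbs R π) : ℤ) = MvPolynomial.eval (evalPoint n (fullCycleType π)) P

variable {R}

lemma mem_graphEmbs {n : ℕ} {π : Equiv.Perm (Fin n)} {φ : V → Fin n} :
    φ ∈ graphEmbs R π ↔ Function.Injective φ ∧ ∀ x y, R x y → π (φ x) = φ y := by
  simp [graphEmbs]

lemma isolatedCount_eq_zero (h : ∀ x, ¬ ∀ u, ¬ R x u ∧ ¬ R u x) : isolatedCount R = 0 :=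
  Finset.card_eq_zero.2 (Finset.filter_eq_empty_iff.2 fun x _ => h x)

lemma singleEdgeCount_le_card {α : Type*} {s : Finset α} {f : V → α} (hR : IsPartialInj R)
    (hf : Function.Injective f)
    (h : ∀ a b, R a b → (∀ u, ¬ R u a) → (∀ u, ¬ R b u) → f a ∈ s) : singleEdgeCount R ≤ #s := by
  refine Finset.card_le_card_of_injOn (fun p => f p.1) ?_ ?_
  · rintro ⟨a, b⟩ hp
    obtain ⟨hab, ha, hb⟩ := (Finset.mem_filter.1 (Finset.mem_coe.1 hp)).2
    exact h a b hab ha hb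
  · rintro ⟨a, b⟩ hp ⟨c, d⟩ hq hac
    have hab := (Finset.mem_filter.1 (Finset.mem_coe.1 hp)).2.1
    have hcd := (Finset.mem_filter.1 (Finset.mem_coe.1 hq)).2.1
    obtain rfl := hf hac
    exact Prod.ext rfl (hR.right_unique hab hcd)

end Counts

lemma HasTopBound.congr {V W : Type} [Fintype V] [Fintype W] {R : W → W → Prop} (e : V ≃ W)
    (h : HasTopBound fun a b => R (e a) (e b)) : HasTopBound R := by
  have h1 : edgeCount (fun a b => R (e a) (e b)) = edgeCount R :=
    Finset.card_equiv (e.prodCongr e) fun p => by simp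
  have h2 : loopCount (fun a b => R (e a) (e b)) = loopCount R :=
    Finset.card_equiv e fun p => by simp
  have h3 : isolatedCount (fun a b => R (e a) (e b)) = isolatedCount R :=
    Finset.card_equiv e fun p => by simp [e.forall_congr_left]
  have h4 : singleEdgeCount (fun a b => R (e a) (e b)) = singleEdgeCount R :=
    Finset.card_equiv (e.prodCongr e) fun p => by simp [e.forall_congr_left]
  have h5 : ∀ n (π : Equiv.Perm (Fin n)),
      #(graphEmbs (fun a b => R (e a) (e b)) π) = #(graphEmbs R π) := fun n π =>
    Finset.card_equiv (e.arrowCongr (Equiv.refl _)) fun φ => by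
      have h6 : Function.Injective (e.arrowCongr (Equiv.refl _) φ) ↔ Function.Injective φ :=
        e.symm.injective_comp φ
      simp [graphEmbs, e.forall_congr_left, h6]
  obtain ⟨P, hP, hPe⟩ := h
  rw [h1, h2, h3, h4] at hP
  exact ⟨P, hP, fun n π => by rw [← h5, hPe]⟩

lemma hasTopBound_of_forall_exists {V : Type} [Fintype V] {R : V → V → Prop} (hR : IsPartialInj R)
    (h : ∀ y, ∃ x, R x y) : HasTopBound R := by
  choose g hg using h
  have hgi : Function.Injective g := fun x y hxy => hR.right_unique (hg x) (hxy ▸ hg y)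
  set σ := (Equiv.ofBijective g hgi.bijective_of_finite).symm with hσ
  have hRσ : ∀ x y, R x y ↔ σ x = y := by
    intro x y
    rw [hσ, Equiv.symm_apply_eq, Equiv.ofBijective_apply]
    constructor
    · exact fun h => hR.left_unique h (hg y)
    · rintro rfl
      exact hg y
  obtain ⟨P, hP, hPe⟩ := exists_topBound_permEmbs _ V σ rfl
  have hedge : edgeCount R = Fintype.card V := by
    rw [edgeCount, ← Finset.card_univ]
    refine (Finset.card_bij (fun x _ => (x, σ x)) ?_ ?_ ?_).symm
    · intro x _
      simp [hRσ]
    · intro x _ y _ hxy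
      exact congrArg Prod.fst hxy
    · rintro ⟨x, y⟩ hxy
      refine ⟨x, Finset.mem_univ _, ?_⟩
      simpa [hRσ] using hxy
  have hloop : loopCount R = fixCount σ := by
    rw [loopCount, fixCount]
    congr 1
    ext x
    simp [hRσ]
  refine ⟨P, hP.mono (by omega) fun _ => by omega, fun n π => ?_⟩
  rw [← hPe]
  congr 2
  ext φ
  simp only [graphEmbs, permEmbs, Finset.mem_filter, Finset.mem_univ, true_and, hRσ]
  refine and_congr_right fun _ => ⟨fun h x => h x _ rfl, ?_⟩
  rintro h x _ rfl
  exact h x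

section OptionVertex

variable {W : Type} {R : Option W → Option W → Prop}

/-- The relation induced on the vertices other than `none`. -/
def restrictSome (R : Option W → Option W → Prop) (a b : W) : Prop := R (some a) (some b)

/-- The relation with the edge `w → v` added. -/
def addEdge (R : W → W → Prop) (w v a b : W) : Prop := R a b ∨ a = w ∧ b = v

lemma IsPartialInj.restrictSome (hR : IsPartialInj R) : IsPartialInj (restrictSome R) :=
  ⟨fun h h' => Option.some_injective _ (hR.right_unique h h'),
    fun h h' => Option.some_injective _ (hR.left_unique h h')⟩

/-- The embedding of pairs induced by `some`. -/
def someProd (W : Type) : W × W ↪ Option W × Option W :=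
  Function.Embedding.some.prodMap Function.Embedding.some

lemma isolated_some (hR : IsPartialInj R) (hsrc : ∀ u, ¬ R u none) {v : W} (hv : R none (some v))
    {x : W} (hxv : x ≠ v)
    (hx : ∀ u, ¬ restrictSome R x u ∧ ¬ restrictSome R u x) (u : Option W) :
    ¬ R (some x) u ∧ ¬ R u (some x) := by
  rcases u with _ | u
  · exact ⟨hsrc _, fun h => hxv (Option.some_injective _ (hR.right_unique h hv))⟩
  · exact hx u

lemma source_ne (hR : IsPartialInj R) {v : W} (hv : R none (some v))
    {a : W} {x : W} (h : restrictSome R a x) : x ≠ v := by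
  rintro rfl
  cases hR.left_unique h hv

lemma single_edge_some (hR : IsPartialInj R) (hsrc : ∀ u, ¬ R u none) {v : W} (hv : R none (some v))
    {a b : W} (hab : restrictSome R a b) (hav : a ≠ v)
    (ha : ∀ u, ¬ restrictSome R u a) (hb : ∀ u, ¬ restrictSome R b u) :
    R (some a) (some b) ∧ (∀ u, ¬ R u (some a)) ∧ ∀ u, ¬ R (some b) u := by
  refine ⟨hab, ?_, ?_⟩
  · rintro (_ | u) h
    · exact hav (Option.some_injective _ (hR.right_unique h hv))
    · exact ha u h
  · rintro (_ | u) h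
    · exact hsrc _ h
    · exact hb u h

lemma single_edge_none (hsrc : ∀ u, ¬ R u none) {v : W} (hv : R none (some v))
    (hvs : ∀ u, ¬ restrictSome R v u) :
    R none (some v) ∧ (∀ u, ¬ R u none) ∧ ∀ u, ¬ R (some v) u := by
  refine ⟨hv, hsrc, ?_⟩
  rintro (_ | u) h
  · exact hsrc _ h
  · exact hvs u h

lemma isPartialInj_addEdge (hR : IsPartialInj R) {v : W} (hv : R none (some v))
    {w : W} (hw : ∀ u, ¬ restrictSome R w u) :
    IsPartialInj (addEdge (restrictSome R) w v) := by
  constructor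
  · rintro x y y' (h | ⟨rfl, rfl⟩) (h' | ⟨h1, rfl⟩)
    exacts [hR.restrictSome.right_unique h h', absurd (h1 ▸ h) (hw _), absurd h' (hw _), rfl]
  · rintro x x' y (h | ⟨rfl, rfl⟩) (h' | ⟨rfl, h1⟩)
    exacts [hR.restrictSome.left_unique h h', absurd h1 (source_ne hR hv h),
      absurd rfl (source_ne hR hv h'), rfl]

variable [Fintype W]

lemma loopCount_restrictSome (hsrc : ∀ u, ¬ R u none) :
    loopCount (restrictSome R) = loopCount R := by
  rw [loopCount, loopCount, ← Finset.card_map Function.Embedding.some]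
  congr 1
  ext x
  cases x
  · simp [hsrc]
  · simp only [Finset.mem_map, Finset.mem_filter, Finset.mem_univ, true_and,
      Function.Embedding.some_apply, Option.some.injEq, exists_eq_right]
    rfl

lemma hasTopBound_of_isolated (hsrc : ∀ u, ¬ R u none) (hsink : ∀ u, ¬ R none u)
    (h : HasTopBound (restrictSome R)) : HasTopBound R := by
  obtain ⟨P, hP, hPe⟩ := h
  have hedge : edgeCount (restrictSome R) ≤ edgeCount R := by
    rw [edgeCount, ← Finset.card_map (someProd W)]
    refine Finset.card_le_card fun p hp => ?_
    obtain ⟨⟨a, b⟩, hab, rfl⟩ := Finset.mem_map.1 hp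
    exact Finset.mem_filter.2 ⟨Finset.mem_univ _, (Finset.mem_filter.1 hab).2⟩
  have hedge' : edgeCount R ≤ edgeCount (restrictSome R) := by
    rw [edgeCount, edgeCount, ← Finset.card_map (someProd W)]
    refine Finset.card_le_card fun p hp => ?_
    obtain ⟨a, b⟩ := p
    rw [Finset.mem_filter] at hp
    rcases a with _ | a
    · exact absurd hp.2 (hsink _)
    rcases b with _ | b
    · exact absurd hp.2 (hsrc _)
    exact Finset.mem_map.2 ⟨(a, b), Finset.mem_filter.2 ⟨Finset.mem_univ _, hp.2⟩, rfl⟩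
  have hiso : isolatedCount (restrictSome R) + 1 ≤ isolatedCount R := by
    rw [isolatedCount, ← Finset.card_map Function.Embedding.some,
      ← Finset.card_insert_of_notMem (a := none) (by simp)]
    refine Finset.card_le_card fun p hp => ?_
    rcases p with _ | p
    · simp [hsrc, hsink]
    · simp only [Finset.mem_insert, reduceCtorEq, Finset.mem_map, Finset.mem_filter,
        Finset.mem_univ, true_and, Function.Embedding.some_apply, Option.some.injEq,
        exists_eq_right, false_or] at hp ⊢
      rintro (_ | u)
      exacts [⟨hsrc _, hsink _⟩, hp u]
  have hsing : singleEdgeCount (restrictSome R) ≤ singleEdgeCount R := by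
    rw [singleEdgeCount, ← Finset.card_map (someProd W)]
    refine Finset.card_le_card fun p hp => ?_
    obtain ⟨⟨a, b⟩, hab, rfl⟩ := Finset.mem_map.1 hp
    simp only [Finset.mem_filter, Finset.mem_univ, true_and] at hab ⊢
    refine ⟨hab.1, ?_, ?_⟩
    · rintro (_ | u)
      exacts [hsink _, hab.2.1 u]
    · rintro (_ | u)
      exacts [hsrc _, hab.2.2 u]
  have hsing' : singleEdgeCount (restrictSome R) + isolatedCount (restrictSome R) + 1 ≤
    singleEdgeCount R + isolatedCount R := by omega
  have hloop := loopCount_restrictSome hsrc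
  refine ⟨_, ((topBound_C_mul_X_sub_C 0 1 (Fintype.card W)).mul hP).mono ?_ fun _ => ?_,
    fun n π => ?_⟩
  · simp only [Nat.zero_le, max_eq_right]
    omega
  · simp only [zero_ne_one, if_false, zero_le, if_true]
    omega
  · rw [map_mul, ← hPe, map_sub, map_mul, MvPolynomial.eval_C, MvPolynomial.eval_C,
      MvPolynomial.eval_X, evalPoint, if_pos rfl, one_mul]
    rw [Finset.card_eq_sum_card_fiberwise (t := graphEmbs (restrictSome R) π)
      (f := fun φ => φ ∘ some), Nat.cast_sum, Finset.sum_congr rfl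
      (g := fun _ => ((n : ℤ) - Fintype.card W)), Finset.sum_const, nsmul_eq_mul, mul_comm]
    · intro ψ hψ
      simp only [graphEmbs, Finset.mem_filter, Finset.mem_univ, true_and] at hψ
      have hcard : #{φ ∈ graphEmbs R π | φ ∘ some = ψ} = #(Finset.univ.image ψ)ᶜ := by
        refine Finset.card_bij (fun φ _ => φ none) ?_ ?_ ?_
        · intro φ hφ
          simp only [graphEmbs, Finset.mem_filter, Finset.mem_univ, true_and] at hφ
          obtain ⟨⟨hi, -⟩, rfl⟩ := hφ
          simp [hi.eq_iff]
        · intro φ hφ φ' hφ' h0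
          have h1 := (Finset.mem_filter.1 hφ).2.trans (Finset.mem_filter.1 hφ').2.symm
          funext x
          cases x
          exacts [h0, congrFun h1 _]
        · intro x hx
          refine ⟨fun o => o.elim x ψ, ?_, rfl⟩
          simp only [graphEmbs, Finset.mem_filter, Finset.mem_univ, true_and]
          refine ⟨⟨?_, ?_⟩, rfl⟩
          · have hx' : ∀ a, ψ a ≠ x := by simpa using hx
            rintro (_ | a) (_ | b) hab
            exacts [rfl, absurd hab.symm (hx' b), absurd hab (hx' a), congrArg some (hψ.1 hab)]
          · rintro (_ | a) (_ | b) hab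
            exacts [absurd hab (hsrc _), absurd hab (hsink _), absurd hab (hsrc _), hψ.2 a b hab]
      have hle := Fintype.card_le_of_injective ψ hψ.1
      rw [Fintype.card_fin] at hle
      rw [hcard, Finset.card_compl, Finset.card_image_of_injective _ hψ.1, Fintype.card_fin,
        Finset.card_univ, Nat.cast_sub hle]
    · intro φ hφ
      simp only [graphEmbs, Finset.coe_filter, Finset.mem_univ, true_and, Set.mem_ofPred_eq]
        at hφ ⊢
      exact ⟨hφ.1.comp (Option.some_injective _), fun a b => hφ.2 _ _⟩

lemma card_graphEmbs_restrictSome (hR : IsPartialInj R) (hsrc : ∀ u, ¬ R u none) {v : W}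
    (hv : R none (some v)) {n : ℕ} (π : Equiv.Perm (Fin n)) :
    #(graphEmbs (restrictSome R) π) = #(graphEmbs R π) +
      ∑ w with ∀ u, ¬ restrictSome R w u, #(graphEmbs (addEdge (restrictSome R) w v) π) := by
  rw [← Finset.card_filter_add_card_filter_not (s := graphEmbs (restrictSome R) π)
    (fun φ => ∀ w, π (φ w) ≠ φ v)]
  congr 1
  · refine (Finset.card_bij (fun φ _ => φ ∘ some) ?_ ?_ ?_).symm
    · intro φ hφ
      simp only [graphEmbs, Finset.mem_filter, Finset.mem_univ, true_and] at hφ ⊢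
      refine ⟨⟨hφ.1.comp (Option.some_injective _), fun a b => hφ.2 _ _⟩, fun w hw => ?_⟩
      have h1 : π (φ (some w)) = φ (some v) := hw
      rw [← hφ.2 _ _ hv, π.injective.eq_iff, hφ.1.eq_iff] at h1
      cases h1
    · intro φ hφ φ' hφ' h
      simp only [graphEmbs, Finset.mem_filter, Finset.mem_univ, true_and] at hφ hφ'
      have h1 : ∀ a, φ (some a) = φ' (some a) := congrFun h
      funext x
      cases x
      · rw [← π.injective.eq_iff, hφ.2 _ _ hv, hφ'.2 _ _ hv, h1]
      · exact h1 _
    · intro ψ hψ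
      simp only [graphEmbs, Finset.mem_filter, Finset.mem_univ, true_and] at hψ
      obtain ⟨⟨hi, he⟩, hne⟩ := hψ
      have hne' : ∀ a, ψ a ≠ π.symm (ψ v) := fun a h => hne a (by rw [h, Equiv.apply_symm_apply])
      refine ⟨fun o => o.elim (π.symm (ψ v)) ψ, ?_, rfl⟩
      simp only [graphEmbs, Finset.mem_filter, Finset.mem_univ, true_and]
      constructor
      · rintro (_ | a) (_ | b) hab
        exacts [rfl, absurd hab.symm (hne' b), absurd hab (hne' a), congrArg some (hi hab)]
      · rintro (_ | a) (_ | b) hab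
        · exact absurd hab (hsrc _)
        · obtain rfl := Option.some_injective _ (hR.right_unique hab hv)
          exact Equiv.apply_symm_apply _ _
        · exact absurd hab (hsrc _)
        · exact he a b hab
  · rw [← Finset.card_biUnion]
    · congr 1
      ext φ
      simp only [graphEmbs, Finset.mem_filter, Finset.mem_univ, true_and, Finset.mem_biUnion,
        not_forall, not_not]
      constructor
      · rintro ⟨⟨hi, he⟩, w, hw⟩
        refine ⟨w, fun u hu => ?_, hi, ?_⟩
        · have h1 := he _ _ hu
          rw [hw, hi.eq_iff] at h1
          subst h1
          cases hR.left_unique hu hv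
        · rintro a b (hab | ⟨rfl, rfl⟩)
          exacts [he a b hab, hw]
      · rintro ⟨w, -, hi, he⟩
        exact ⟨⟨hi, fun a b hab => he a b (Or.inl hab)⟩, w, he w v (Or.inr ⟨rfl, rfl⟩)⟩
    · intro w _ w' _ hww'
      rw [Function.onFun, Finset.disjoint_left]
      intro φ hφ hφ'
      simp only [graphEmbs, Finset.mem_filter, Finset.mem_univ, true_and] at hφ hφ'
      have h1 := (hφ.2 w v (Or.inr ⟨rfl, rfl⟩)).trans (hφ'.2 w' v (Or.inr ⟨rfl, rfl⟩)).symm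
      exact hww' (hφ.1 (π.injective h1))

lemma edgeCount_restrictSome_add_one {v : W}
    (hv : R none (some v)) : edgeCount (restrictSome R) + 1 ≤ edgeCount R := by
  rw [edgeCount, ← Finset.card_map (someProd W),
    ← Finset.card_insert_of_notMem (a := (none, some v)) (by simp [someProd])]
  refine Finset.card_le_card fun p hp => ?_
  rcases Finset.mem_insert.1 hp with rfl | hp
  · simpa using hv
  · obtain ⟨⟨a, b⟩, hab, rfl⟩ := Finset.mem_map.1 hp
    exact Finset.mem_filter.2 ⟨Finset.mem_univ _, (Finset.mem_filter.1 hab).2⟩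

lemma edgeCount_addEdge_le (R : W → W → Prop) (w v : W) :
    edgeCount (addEdge R w v) ≤ edgeCount R + 1 := by
  rw [edgeCount, edgeCount]
  refine le_trans (Finset.card_le_card fun p hp => ?_) (Finset.card_insert_le (w, v) _)
  rcases (Finset.mem_filter.1 hp).2 with h | ⟨h1, h2⟩
  · exact Finset.mem_insert_of_mem (Finset.mem_filter.2 ⟨Finset.mem_univ _, h⟩)
  · exact Finset.mem_insert.2 (Or.inl (Prod.ext h1 h2))

lemma loopCount_le_loopCount_addEdge (R : W → W → Prop) (w v : W) :
    loopCount R ≤ loopCount (addEdge R w v) :=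
  Finset.card_le_card <| Finset.monotone_filter_right _ fun _ _ h => Or.inl h

lemma loopCount_addEdge_of_ne (R : W → W → Prop) {w v : W} (hwv : w ≠ v) :
    loopCount (addEdge R w v) ≤ loopCount R :=
  Finset.card_le_card <| Finset.monotone_filter_right _ fun _ _ h =>
    h.resolve_right fun h => hwv (h.1.symm.trans h.2)

lemma loopCount_addEdge_self (R : W → W → Prop) (v : W) :
    loopCount (addEdge R v v) ≤ loopCount R + 1 := by
  rw [loopCount, loopCount]
  refine le_trans (Finset.card_le_card fun x hx => ?_) (Finset.card_insert_le v _)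
  rcases (Finset.mem_filter.1 hx).2 with h | ⟨h, -⟩
  · exact Finset.mem_insert_of_mem (Finset.mem_filter.2 ⟨Finset.mem_univ _, h⟩)
  · exact Finset.mem_insert.2 (Or.inl h)

lemma isolatedCount_restrictSome_le (hR : IsPartialInj R) (hsrc : ∀ u, ¬ R u none)
    {v : W} (hv : R none (some v)) :
    isolatedCount (restrictSome R) ≤ isolatedCount R + 1 := by
  rw [isolatedCount, isolatedCount, ← Finset.card_map Function.Embedding.some]
  refine le_trans (Finset.card_le_card fun p hp => ?_) (Finset.card_insert_le (some v) _)
  obtain ⟨x, hx, rfl⟩ := Finset.mem_map.1 hp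
  rw [Finset.mem_filter] at hx
  by_cases hxv : x = v
  · exact Finset.mem_insert.2 (Or.inl (congrArg some hxv))
  · exact Finset.mem_insert_of_mem (Finset.mem_filter.2 ⟨Finset.mem_univ _,
      isolated_some hR hsrc hv hxv hx.2⟩)

lemma isolatedCount_restrictSome_le_of_not_isolated (hR : IsPartialInj R) (hsrc : ∀ u, ¬ R u none)
    {v : W} (hv : R none (some v))
    (hvi : ¬ ∀ u, ¬ restrictSome R v u ∧ ¬ restrictSome R u v) :
    isolatedCount (restrictSome R) ≤ isolatedCount R := by
  rw [isolatedCount, isolatedCount, ← Finset.card_map Function.Embedding.some]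
  refine Finset.card_le_card fun p hp => ?_
  obtain ⟨x, hx, rfl⟩ := Finset.mem_map.1 hp
  rw [Finset.mem_filter] at hx
  have hxv : x ≠ v := fun h => hvi (h ▸ hx.2)
  exact Finset.mem_filter.2 ⟨Finset.mem_univ _, isolated_some hR hsrc hv hxv hx.2⟩

lemma isolatedCount_addEdge_le (hR : IsPartialInj R) (hsrc : ∀ u, ¬ R u none)
    {v : W} (hv : R none (some v))
    (w : W) :
    isolatedCount (addEdge (restrictSome R) w v) ≤ isolatedCount R := by
  rw [isolatedCount, isolatedCount, ← Finset.card_map Function.Embedding.some]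
  refine Finset.card_le_card fun p hp => ?_
  obtain ⟨x, hx, rfl⟩ := Finset.mem_map.1 hp
  rw [Finset.mem_filter] at hx
  have hxv : x ≠ v := fun h => (hx.2 w).2 (Or.inr ⟨rfl, h⟩)
  exact Finset.mem_filter.2 ⟨Finset.mem_univ _, isolated_some hR hsrc hv hxv fun u =>
    ⟨fun h => (hx.2 u).1 (Or.inl h), fun h => (hx.2 u).2 (Or.inl h)⟩⟩

lemma isolatedCount_addEdge_lt (hR : IsPartialInj R) (hsrc : ∀ u, ¬ R u none)
    {v : W} (hv : R none (some v))
    {w : W} (hwv : w ≠ v)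
    (hw : ∀ u, ¬ restrictSome R w u ∧ ¬ restrictSome R u w) :
    isolatedCount (addEdge (restrictSome R) w v) < isolatedCount R := by
  rw [isolatedCount, isolatedCount, ← Finset.card_map Function.Embedding.some]
  refine Finset.card_lt_card ((Finset.ssubset_iff_of_subset fun p hp => ?_).2 ⟨some w, ?_, ?_⟩)
  · obtain ⟨x, hx, rfl⟩ := Finset.mem_map.1 hp
    rw [Finset.mem_filter] at hx
    have hxv : x ≠ v := fun h => (hx.2 w).2 (Or.inr ⟨rfl, h⟩)
    exact Finset.mem_filter.2 ⟨Finset.mem_univ _, isolated_some hR hsrc hv hxv fun u =>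
      ⟨fun h => (hx.2 u).1 (Or.inl h), fun h => (hx.2 u).2 (Or.inl h)⟩⟩
  · exact Finset.mem_filter.2 ⟨Finset.mem_univ _, isolated_some hR hsrc hv hwv hw⟩
  · intro h
    obtain ⟨x, hx, hxw⟩ := Finset.mem_map.1 h
    obtain rfl := Option.some_injective _ hxw
    exact ((Finset.mem_filter.1 hx).2 v).1 (Or.inr ⟨rfl, rfl⟩)

lemma singleEdgeCount_restrictSome_add_one (hR : IsPartialInj R) (hsrc : ∀ u, ¬ R u none)
    {v : W} (hv : R none (some v))
    (hvs : ∀ u, ¬ restrictSome R v u) :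
    singleEdgeCount (restrictSome R) + 1 ≤ singleEdgeCount R := by
  rw [singleEdgeCount, ← Finset.card_map (someProd W),
    ← Finset.card_insert_of_notMem (a := (none, some v)) (by simp [someProd])]
  refine Finset.card_le_card fun p hp => ?_
  rcases Finset.mem_insert.1 hp with rfl | hp
  · exact Finset.mem_filter.2 ⟨Finset.mem_univ _, single_edge_none hsrc hv hvs⟩
  · obtain ⟨⟨a, b⟩, hab, rfl⟩ := Finset.mem_map.1 hp
    obtain ⟨-, h1, h2, h3⟩ := Finset.mem_filter.1 hab
    refine Finset.mem_filter.2 ⟨Finset.mem_univ _, single_edge_some hR hsrc hv h1 ?_ h2 h3⟩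
    rintro rfl
    exact hvs _ h1

lemma singleEdgeCount_addEdge_self_add_one (hR : IsPartialInj R) (hsrc : ∀ u, ¬ R u none)
    {v : W} (hv : R none (some v))
    (hvs : ∀ u, ¬ restrictSome R v u) :
    singleEdgeCount (addEdge (restrictSome R) v v) + 1 ≤ singleEdgeCount R := by
  refine le_trans (Nat.add_le_add_right ?_ 1) (singleEdgeCount_restrictSome_add_one hR hsrc hv hvs)
  refine Finset.card_le_card <| Finset.monotone_filter_right _ fun p _ h => ?_
  refine ⟨h.1.resolve_right fun h' => h.2.1 v (Or.inr ⟨rfl, h'.1⟩),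
    fun u hu => h.2.1 u (Or.inl hu), fun u hu => h.2.2 u (Or.inl hu)⟩

lemma singleEdgeCount_addEdge_le (hR : IsPartialInj R) (hsrc : ∀ u, ¬ R u none)
    {v : W} (hv : R none (some v))
    {w z : W} (hz : restrictSome R z w) :
    singleEdgeCount (addEdge (restrictSome R) w v) ≤ singleEdgeCount R := by
  rw [singleEdgeCount, ← Finset.card_map (someProd W)]
  refine Finset.card_le_card fun p hp => ?_
  obtain ⟨⟨a, b⟩, hab, rfl⟩ := Finset.mem_map.1 hp
  obtain ⟨-, h1, h2, h3⟩ := Finset.mem_filter.1 hab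
  dsimp only at h1 h2 h3
  refine Finset.mem_filter.2 ⟨Finset.mem_univ _, single_edge_some hR hsrc hv
    (h1.resolve_right ?_) ?_ (fun u hu => h2 u (Or.inl hu)) fun u hu => h3 u (Or.inl hu)⟩
  · rintro ⟨rfl, -⟩
    exact h2 z (Or.inl hz)
  · rintro rfl
    exact h2 w (Or.inr ⟨rfl, rfl⟩)

lemma hasTopBound_of_source (hR : IsPartialInj R) (hsrc : ∀ u, ¬ R u none)
    {v : W} (hv : R none (some v))
    (h : HasTopBound (restrictSome R))
    (hadd : ∀ w, (∀ u, ¬ restrictSome R w u) → HasTopBound (addEdge (restrictSome R) w v)) :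
    HasTopBound R := by
  obtain ⟨P, hP, hPe⟩ := h
  choose! Q hQ hQe using hadd
  have hedge := edgeCount_restrictSome_add_one hv
  have hloop := loopCount_restrictSome hsrc
  refine ⟨P - ∑ w with ∀ u, ¬ restrictSome R w u, Q w,
    (hP.mono ?_ ?_).sub (TopBound.sum _ fun w hw => ?_), fun n π => ?_⟩
  · have := isolatedCount_restrictSome_le hR hsrc hv
    omega
  · intro heq
    by_cases hvi : ∀ u, ¬ restrictSome R v u ∧ ¬ restrictSome R u v
    · have := singleEdgeCount_restrictSome_add_one hR hsrc hv fun u => (hvi u).1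
      have := isolatedCount_restrictSome_le hR hsrc hv
      omega
    · have := isolatedCount_restrictSome_le_of_not_isolated hR hsrc hv hvi
      omega
  · have hw := (Finset.mem_filter.1 hw).2
    have h1 := edgeCount_addEdge_le (restrictSome R) w v
    have h2 := isolatedCount_addEdge_le hR hsrc hv w
    have h3 := loopCount_le_loopCount_addEdge (restrictSome R) w v
    refine (hQ w hw).mono (by omega) fun heq => ?_
    by_cases hwv : w = v
    · subst hwv
      have := loopCount_addEdge_self (restrictSome R) w
      have := singleEdgeCount_addEdge_self_add_one hR hsrc hv hw
      omega
    · have h4 := loopCount_addEdge_of_ne (restrictSome R) hwv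
      by_cases hz : ∃ z, restrictSome R z w
      · obtain ⟨z, hz⟩ := hz
        have := singleEdgeCount_addEdge_le hR hsrc hv hz
        omega
      · have := isolatedCount_addEdge_lt hR hsrc hv hwv fun u => ⟨hw u, fun h => hz ⟨u, h⟩⟩
        omega
  · rw [map_sub, map_sum, ← hPe, card_graphEmbs_restrictSome hR hsrc hv, Nat.cast_add,
      Nat.cast_sum, eq_sub_iff_add_eq]
    congr 1
    exact Finset.sum_congr rfl fun w hw => (hQe w (Finset.mem_filter.1 hw).2 n π).symm

end OptionVertex

theorem hasTopBound (m : ℕ) : ∀ (V : Type) [Fintype V] (R : V → V → Prop), IsPartialInj R →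
    Fintype.card V = m → HasTopBound R := by
  induction m with
  | zero =>
    intro V _ R hR hV
    have := Fintype.card_eq_zero_iff.1 hV
    exact hasTopBound_of_forall_exists hR fun y => isEmptyElim y
  | succ m ih =>
    intro V _ R hR hV
    by_cases hsrc : ∀ y, ∃ x, R x y
    · exact hasTopBound_of_forall_exists hR hsrc
    · push Not at hsrc
      obtain ⟨v₀, hv₀⟩ := hsrc
      set e := Equiv.optionSubtypeNe v₀
      refine HasTopBound.congr e ?_
      set S : Option {x // x ≠ v₀} → Option {x // x ≠ v₀} → Prop := fun a b => R (e a) (e b)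
      have hS : IsPartialInj S := ⟨fun h h' => e.injective (hR.right_unique h h'),
        fun h h' => e.injective (hR.left_unique h h')⟩
      have hSsrc : ∀ u, ¬ S u none := fun u => by simpa [S, e] using hv₀ _
      have hcard : Fintype.card {x // x ≠ v₀} = m := by
        have := Fintype.card_congr e
        rw [Fintype.card_option] at this
        omega
      have h0 := ih _ _ hS.restrictSome hcard
      by_cases hv : ∃ u, S none u
      · obtain ⟨_ | v, hv⟩ := hv
        · exact absurd hv (hSsrc _)
        · exact hasTopBound_of_source hS hSsrc hv h0 fun w hw =>
            ih _ _ (isPartialInj_addEdge hS hv hw) hcard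
      · push Not at hv
        exact hasTopBound_of_isolated hSsrc hv h0

lemma fullCycleType_conj {n : ℕ} (τ π : Equiv.Perm (Fin n)) :
    fullCycleType (τ * π * τ⁻¹) = fullCycleType π := by
  rw [fullCycleType, fullCycleType, Equiv.Perm.cycleType_conj, Equiv.Perm.card_support_conj]

lemma mem_KClass {n : ℕ} {lam : Nat.Partition n} {π : Equiv.Perm (Fin n)} :
    π ∈ KClass lam ↔ fullCycleType π = lam.parts := by
  simp [KClass]

lemma KClass_nonempty {n : ℕ} (lam : Nat.Partition n) : (KClass lam).Nonempty := by
  have hle : (lam.parts.filter (2 ≤ ·)).sum ≤ n := by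
    conv_rhs => rw [← lam.parts_sum, ← Multiset.filter_add_not (2 ≤ ·) lam.parts]
    simp
  obtain ⟨π, hπ⟩ := (Equiv.Perm.exists_with_cycleType_iff (Fin n)
    (m := lam.parts.filter (2 ≤ ·))).2 ⟨by simpa using hle,
      fun a ha => (Multiset.mem_filter.1 ha).2⟩
  refine ⟨π, mem_KClass.2 ?_⟩
  have hones : lam.parts.filter (fun a => ¬ 2 ≤ a) =
      Multiset.replicate (lam.parts.filter (fun a => ¬ 2 ≤ a)).card 1 := by
    refine Multiset.eq_replicate_card.2 fun a ha => ?_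
    obtain ⟨ha, ha2⟩ := Multiset.mem_filter.1 ha
    have := lam.parts_pos ha
    omega
  have hsum := lam.parts_sum
  rw [← Multiset.filter_add_not (2 ≤ ·) lam.parts, Multiset.sum_add, hones,
    Multiset.sum_replicate, smul_eq_mul, mul_one, ← hπ, Equiv.Perm.sum_cycleType] at hsum
  rw [fullCycleType, ← Multiset.filter_add_not (2 ≤ ·) lam.parts, hones, hπ]
  congr 2
  omega

/-- Conjugation acts transitively on injections, so all of them satisfy a given set of relations
equally often on a conjugacy class. -/
lemma card_KClass_filter_eq {n k m : ℕ} (lam : Nat.Partition n) (U V : Fin k → Fin m)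
    {ι φ : Fin m → Fin n} (hι : Function.Injective ι) (hφ : Function.Injective φ) :
    #{π ∈ KClass lam | ∀ ℓ, π (φ (U ℓ)) = φ (V ℓ)} =
      #{π ∈ KClass lam | ∀ ℓ, π (ι (U ℓ)) = ι (V ℓ)} := by
  obtain ⟨τ, hτ⟩ := Equiv.Perm.exists_extending_pair ι φ hι hφ
  symm
  refine Finset.card_equiv (MulAut.conj τ).toEquiv fun π => ?_
  have hconj (ℓ : Fin k) :
      (τ * π * τ⁻¹) (φ (U ℓ)) = φ (V ℓ) ↔ π (ι (U ℓ)) = ι (V ℓ) := by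
    simp only [Equiv.Perm.mul_apply, ← hτ, Equiv.Perm.inv_def, Equiv.symm_apply_apply,
      EmbeddingLike.apply_eq_iff_eq]
  simp only [Finset.mem_filter, mem_KClass, MulEquiv.toEquiv_eq_coe, MulEquiv.coe_toEquiv,
    MulAut.conj_apply, fullCycleType_conj, hconj]

/-- The graph encoded by a pair of tuples. -/
def tupleRel {k m : ℕ} (U V : Fin k → Fin m) (a b : Fin m) : Prop := ∃ ℓ, U ℓ = a ∧ V ℓ = b

lemma mem_graphEmbs_tupleRel {n k m : ℕ} {U V : Fin k → Fin m} {π : Equiv.Perm (Fin n)}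
    {φ : Fin m → Fin n} : φ ∈ graphEmbs (tupleRel U V) π ↔
      Function.Injective φ ∧ ∀ ℓ, π (φ (U ℓ)) = φ (V ℓ) := by
  refine mem_graphEmbs.trans (and_congr_right fun _ => ⟨fun h ℓ => ?_, ?_⟩)
  · exact h _ _ ⟨ℓ, rfl, rfl⟩
  · rintro h x y ⟨ℓ, rfl, rfl⟩
    exact h ℓ

lemma card_filter_injective (V W : Type) [Fintype V] [Fintype W] :
    #{φ : V → W | Function.Injective φ} = (Fintype.card W).descFactorial (Fintype.card V) := by
  rw [← Fintype.card_subtype, Fintype.card_congr (Equiv.subtypeInjectiveEquivEmbedding _ _),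
    Fintype.card_embedding_eq]

lemma card_filter_injective_fin (m n : ℕ) :
    #{φ : Fin m → Fin n | Function.Injective φ} = n.descFactorial m := by
  have h := card_filter_injective (Fin m) (Fin n)
  rw [Fintype.card_fin, Fintype.card_fin] at h
  convert h

lemma sum_card_graphEmbs {n k m : ℕ} (hmn : m ≤ n) (lam : Nat.Partition n) (U V : Fin k → Fin m) :
    ∑ π ∈ KClass lam, #(graphEmbs (tupleRel U V) π) = n.descFactorial m *
      #{π ∈ KClass lam | ∀ ℓ, π (Fin.castLE hmn (U ℓ)) = Fin.castLE hmn (V ℓ)} := by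
  have hfib (π : Equiv.Perm (Fin n)) : graphEmbs (tupleRel U V) π =
      Finset.bipartiteAbove (fun π φ => ∀ ℓ, π (φ (U ℓ)) = φ (V ℓ))
        {φ : Fin m → Fin n | Function.Injective φ} π := by
    ext φ
    simp [mem_graphEmbs_tupleRel, Finset.mem_bipartiteAbove]
  simp only [hfib]
  rw [Finset.sum_card_bipartiteAbove_eq_sum_card_bipartiteBelow,
    Finset.sum_congr rfl fun φ hφ => ?_, Finset.sum_const, card_filter_injective_fin, smul_eq_mul]
  exact card_KClass_filter_eq lam U V (Fin.castLE_injective hmn) (Finset.mem_filter.1 hφ).2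

lemma descFactorial_mul_expect {n k m : ℕ} (hmn : m ≤ n) (lam : Nat.Partition n)
    (U V : Fin k → Fin m) {z : ℤ}
    (hz : ∀ π ∈ KClass lam, (#(graphEmbs (tupleRel U V) π) : ℤ) = z) :
    (n.descFactorial m : ℝ) *
      expect lam (indic (Fin.castLE hmn ∘ U) (Fin.castLE hmn ∘ V)) = z := by
  have hcard : (#(KClass lam) : ℝ) ≠ 0 :=
    Nat.cast_ne_zero.2 (Finset.card_pos.2 (KClass_nonempty lam)).ne'
  have hsum : ∑ π ∈ KClass lam, indic (Fin.castLE hmn ∘ U) (Fin.castLE hmn ∘ V) π =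
      #{π ∈ KClass lam | ∀ ℓ, π (Fin.castLE hmn (U ℓ)) = Fin.castLE hmn (V ℓ)} := by
    simp [indic, Finset.sum_boole]
  have hz' : (∑ π ∈ KClass lam, #(graphEmbs (tupleRel U V) π) : ℝ) = #(KClass lam) * z := by
    rw [Finset.sum_congr rfl (g := fun _ => (z : ℝ)) fun π hπ => by exact_mod_cast hz π hπ]
    simp
  rw [expect, hsum, mul_div_assoc', div_eq_iff hcard, mul_comm (z : ℝ), ← hz']
  exact_mod_cast (sum_card_graphEmbs hmn lam U V).symm

section Tuples

variable {k m : ℕ} {U V : Fin k → Fin m}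

lemma isPartialInj_tupleRel (hU : Function.Injective U) (hV : Function.Injective V) :
    IsPartialInj (tupleRel U V) where
  right_unique := by
    rintro _ _ _ ⟨ℓ, rfl, rfl⟩ ⟨j, hj, rfl⟩
    rw [hU hj]
  left_unique := by
    rintro _ _ _ ⟨ℓ, rfl, rfl⟩ ⟨j, rfl, hj⟩
    rw [hV hj]

lemma edgeCount_tupleRel (hU : Function.Injective U) : edgeCount (tupleRel U V) = k := by
  have h : ({p : Fin m × Fin m | tupleRel U V p.1 p.2} : Finset _) =
      Finset.univ.image fun ℓ => (U ℓ, V ℓ) := by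
    ext ⟨a, b⟩
    simp only [Finset.mem_filter, Finset.mem_univ, true_and, Finset.mem_image, Prod.mk.injEq]
    rfl
  rw [edgeCount, h, Finset.card_image_of_injective _ fun i j hij => hU (Prod.ext_iff.1 hij).1,
    Finset.card_univ, Fintype.card_fin]

lemma isolatedCount_tupleRel
    (packed : Finset.image U Finset.univ ∪ Finset.image V Finset.univ = Finset.univ) :
    isolatedCount (tupleRel U V) = 0 := by
  refine isolatedCount_eq_zero fun x h => ?_
  have hx : x ∈ Finset.image U Finset.univ ∪ Finset.image V Finset.univ := packed ▸ mem_univ x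
  simp only [Finset.mem_union, Finset.mem_image, Finset.mem_univ, true_and] at hx
  obtain ⟨ℓ, rfl⟩ | ⟨ℓ, rfl⟩ := hx
  · exact (h (V ℓ)).1 ⟨ℓ, rfl, rfl⟩
  · exact (h (U ℓ)).2 ⟨ℓ, rfl, rfl⟩

lemma loopCount_tupleRel_zero (U V : Fin 0 → Fin m) : loopCount (tupleRel U V) = 0 := by
  simp [loopCount, tupleRel]

lemma singleEdgeCount_tupleRel_zero (U V : Fin 0 → Fin m) :
    singleEdgeCount (tupleRel U V) = 0 := by
  simp [singleEdgeCount, tupleRel]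

lemma pstep_apply {I J : Fin k → ℕ} (hI : Function.Injective I) (ℓ : Fin k) :
    pstep I J (I ℓ) = some (J ℓ) := by
  have h : ∃ j, I j = I ℓ := ⟨ℓ, rfl⟩
  rw [pstep, dif_pos h, hI h.choose_spec]

lemma pstep_eq_none {I J : Fin k → ℕ} {x : ℕ} (h : ∀ ℓ, I ℓ ≠ x) : pstep I J x = none :=
  dif_neg fun ⟨ℓ, hℓ⟩ => h ℓ hℓ

lemma piter_one {I J : Fin k → ℕ} {x : ℕ} : piter I J 1 x = pstep I J x := by
  rw [piter, piter, Option.bind_some]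

lemma count_sum_replicate (c : ℕ → ℕ) (hk : k ≠ 0) :
    Multiset.count 1 (∑ i ∈ Finset.range (k + 1), Multiset.replicate (c i) i) = c 1 := by
  rw [Multiset.count_sum']
  simp only [Multiset.count_replicate]
  rw [Finset.sum_ite_eq', if_pos (Finset.mem_range.2 (by omega))]

lemma count_one_cyclePart (hU : Function.Injective U) :
    Multiset.count 1 (cyclePart (fun ℓ => (U ℓ : ℕ)) fun ℓ => (V ℓ : ℕ)) =
      loopCount (tupleRel U V) := by
  have hI : Function.Injective fun ℓ => (U ℓ : ℕ) := Fin.val_injective.comp hU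
  rcases eq_or_ne k 0 with rfl | hk
  · rw [loopCount_tupleRel_zero]
    simp [cyclePart, Multiset.count_replicate]
  rw [cyclePart, count_sum_replicate _ hk, cycleMult, Nat.div_one, loopCount,
    ← Finset.card_image_of_injective _ Fin.val_injective]
  congr 1
  ext x
  simp only [Finset.mem_filter, Finset.mem_image, Finset.mem_univ, true_and]
  constructor
  · rintro ⟨-, hx, -⟩
    rw [piter_one] at hx
    by_cases h : ∃ ℓ, (U ℓ : ℕ) = x
    · obtain ⟨ℓ, rfl⟩ := h
      rw [pstep_apply hI ℓ] at hx
      exact ⟨U ℓ, ⟨ℓ, rfl, Fin.ext (Option.some.inj hx)⟩, rfl⟩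
    · rw [pstep_eq_none fun ℓ hℓ => h ⟨ℓ, hℓ⟩] at hx
      cases hx
  · rintro ⟨_, ⟨ℓ, rfl, hℓ⟩, rfl⟩
    refine ⟨by simp [pverts], ?_, fun t h0 h1 => by omega⟩
    rw [piter_one, pstep_apply hI ℓ, hℓ]

lemma singleEdgeCount_le_count_one_pathPart (hU : Function.Injective U)
    (hV : Function.Injective V) :
    singleEdgeCount (tupleRel U V) ≤
      Multiset.count 1 (pathPart (fun ℓ => (U ℓ : ℕ)) fun ℓ => (V ℓ : ℕ)) := by
  have hI : Function.Injective fun ℓ => (U ℓ : ℕ) := Fin.val_injective.comp hU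
  rcases eq_or_ne k 0 with rfl | hk
  · rw [singleEdgeCount_tupleRel_zero]
    exact Nat.zero_le _
  rw [pathPart, count_sum_replicate _ hk, pathMult]
  refine singleEdgeCount_le_card (isPartialInj_tupleRel hU hV) Fin.val_injective ?_
  rintro _ _ ⟨ℓ, rfl, rfl⟩ hsrc hsink
  have h1 : piter (fun ℓ => (U ℓ : ℕ)) (fun ℓ => (V ℓ : ℕ)) 1 (U ℓ) = some (V ℓ : ℕ) := by
    rw [piter_one, pstep_apply hI ℓ]
  refine Finset.mem_filter.2 ⟨by simp [pverts], fun j hj => ?_, by rw [h1]; rfl, ?_⟩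
  · exact hsrc (U j) ⟨j, rfl, Fin.ext hj⟩
  · rw [piter, h1, Option.bind_some]
    exact pstep_eq_none fun j hj => hsink (V j) ⟨j, Fin.ext hj, rfl⟩

end Tuples

/-- Corollary `c:top-degree-moment`.  Let `(U,V)` be (a packed realization
of) a partial permutation of size `k` with cycle–path type `(μ,ν)` and `|U ∪ V| = m`, and let
`F ∈ ℤ[n, m_1, …, m_k]` be the polynomial with `(n)_m ⬝ E_λ[1_{IJ}] = F(n, m_1(λ), …, m_k(λ))`
for all partitions `λ`.  Then every monomial `n^{a_0} m_1^{a_1} ⋯ m_k^{a_k}` of `F` of weighted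
degree exactly `k` (with `deg n = 1`, `deg m_i = i`) satisfies `a_1 ≥ m_1(μ)` and
`a_0 + (a_1 - m_1(μ)) ≤ m_1(ν)`. -/
theorem statement5 {k m : ℕ} (μ ν : Multiset ℕ) (U V : Fin k → Fin m)
    (hU : Function.Injective U) (hV : Function.Injective V)
    (packed : Finset.image U Finset.univ ∪ Finset.image V Finset.univ = Finset.univ)
    (hμ : cyclePart (fun ℓ => (U ℓ : ℕ)) (fun ℓ => (V ℓ : ℕ)) = μ)
    (hν : pathPart (fun ℓ => (U ℓ : ℕ)) (fun ℓ => (V ℓ : ℕ)) = ν)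
    (F : MvPolynomial ℕ ℤ) (hvars : F.vars ⊆ Finset.range (k + 1))
    (hF : ∀ (n : ℕ) (hmn : m ≤ n) (lam : Nat.Partition n),
      (n.descFactorial m : ℝ) *
          expect lam (indic (Fin.castLE hmn ∘ U) (Fin.castLE hmn ∘ V)) =
        ((MvPolynomial.eval
            (fun i => if i = 0 then (n : ℤ) else (Multiset.count i lam.parts : ℤ)) F : ℤ) : ℝ)) :
    ∀ d ∈ F.support, (∑ i ∈ d.support, max i 1 * d i) = k →
      Multiset.count 1 μ ≤ d 1 ∧ d 0 + (d 1 - Multiset.count 1 μ) ≤ Multiset.count 1 ν := by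
  obtain ⟨P, hPtop, hP⟩ := hasTopBound m (Fin m) (tupleRel U V) (isPartialInj_tupleRel hU hV)
    (Fintype.card_fin m)
  have hFP : F = P := by
    refine sub_eq_zero.1 (eq_zero_of_eval_evalPoint m _ fun n hmn lam => ?_)
    have h := descFactorial_mul_expect hmn lam U V
      (z := MvPolynomial.eval (evalPoint n lam.parts) P)
      fun π hπ => by rw [hP, mem_KClass.1 hπ]
    rw [hF n hmn lam, Int.cast_inj] at h
    rw [map_sub, sub_eq_zero]
    exact h
  intro d hd hdk
  rw [edgeCount_tupleRel hU, isolatedCount_tupleRel packed] at hPtop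
  obtain ⟨hlow, hhigh⟩ := (hPtop d (hFP ▸ hd)).2 hdk
  have hν' := singleEdgeCount_le_count_one_pathPart hU hV
  rw [hν] at hν'
  rw [← hμ, count_one_cyclePart hU]
  omega

end PaperStmt
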